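/- Let n be an integer with |n| > 1, let K ≥ 1, M even, and let p₁ < p₂ < ... < p_K < M/2 be natural numbers with p_{i+1} − p_i ≥ K. Suppose 0 ≤ l ≤ K, and suppose integers X, x₁, ..., x_l with 0 ≤ x_i < M, and signs ε_i ∈ {−1, 1}, satisfy X(n^M + 1) = (n^{p₁} + ... + n^{p_K}) − Σ_{i=1}^l ε_i n^{x_i}. Then X = 0, all ε_i = 1, l = K, and {x₁, ..., x_l} = {p₁, ..., p_K} as multisets. -/

import Mathlib

open Finset

/-- The coefficients of `t * Q` modulo `t ^ M + 1`, where `q` lists the coefficients of `Q`. -/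
def negacyclicShift (M : ℕ) (q : ℕ → ℤ) (j : ℕ) : ℤ :=
  if j = 0 then -q (M - 1) else q (j - 1)

/-- The coefficients of `(t - n) * Q` modulo `t ^ M + 1`. -/
def negacyclicDiff (n : ℤ) (M : ℕ) (q : ℕ → ℤ) (j : ℕ) : ℤ :=
  negacyclicShift M q j - n * q j

/-- The indices below `M` at which `q` does not vanish. -/
def supportBelow (M : ℕ) (q : ℕ → ℤ) : Finset ℕ := {j ∈ range M | q j ≠ 0}

/-- The indices immediately following a maximal cyclic run of nonzero values of `q`. -/
def runEnds (M : ℕ) (q : ℕ → ℤ) : Finset ℕ :=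
  {j ∈ range M | q j = 0 ∧ negacyclicShift M q j ≠ 0}

lemma sum_abs_negacyclicShift (M : ℕ) (q : ℕ → ℤ) :
    ∑ j ∈ range M, |negacyclicShift M q j| = ∑ j ∈ range M, |q j| := by
  cases M with
  | zero => simp
  | succ m =>
    rw [sum_range_succ', sum_range_succ (fun j => |q j|)]
    simp [negacyclicShift]

lemma card_support_add_two_mul_card_runEnds_le {n : ℤ} (hn : 1 < |n|) (M : ℕ) (q : ℕ → ℤ) :
    ((#(supportBelow M q) : ℤ) + 2 * #(runEnds M q)) ≤
      ∑ j ∈ range M, |negacyclicDiff n M q j| := by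
  have key : ∀ j ∈ range M, (|q j| - |negacyclicShift M q j|) + ((if q j ≠ 0 then 1 else 0) +
      2 * (if q j = 0 ∧ negacyclicShift M q j ≠ 0 then 1 else 0)) ≤ |negacyclicDiff n M q j| := by
    intro j _
    unfold negacyclicDiff
    by_cases h : q j = 0
    · by_cases h' : negacyclicShift M q j = 0
      · simp [h, h']
      · have := abs_pos.2 h'
        simp only [h, h', mul_zero, sub_zero, abs_zero, ne_eq, not_true_eq_false, if_false,
          not_false_eq_true, and_self, if_true]
        omega
    · have h1 : |n| * |q j| - |negacyclicShift M q j| ≤ |negacyclicShift M q j - n * q j| := by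
        rw [← abs_mul, abs_sub_comm]
        exact abs_sub_abs_le_abs_sub _ _
      have h2 := abs_pos.2 h
      have h3 : 2 * |q j| ≤ |n| * |q j| := by gcongr; omega
      simp only [h, ne_eq, not_false_eq_true, if_true, false_and, if_false]
      omega
  have hsum := sum_le_sum key
  rw [sum_add_distrib, sum_sub_distrib, sum_abs_negacyclicShift, sub_self, zero_add,
    sum_add_distrib, ← mul_sum] at hsum
  rwa [sum_boole, sum_boole] at hsum

lemma forall_ne_zero_of_notMem_runEnds {M : ℕ} {q : ℕ → ℤ} {a K : ℕ} (haM : a + K ≤ M)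
    (ha : q a ≠ 0) (hE : ∀ e, a ≤ e → e < a + K → e ∉ runEnds M q) :
    ∀ k < K, q (a + k) ≠ 0 := by
  intro k hk
  induction k with
  | zero => exact ha
  | succ k ih =>
    intro h
    refine hE (a + (k + 1)) (by omega) (by omega) ?_
    have := ih (by omega)
    refine mem_filter.2 ⟨mem_range.2 (by omega), h, ?_⟩
    simpa [negacyclicShift, ← add_assoc] using this

lemma window_full_or_meets_runEnds {n : ℤ} {M : ℕ} {q : ℕ → ℤ} {a K : ℕ} (hK : 1 ≤ K)
    (haM : a + K ≤ M) (ha : negacyclicDiff n M q a ≠ 0) :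
    Ico a (a + K) ⊆ supportBelow M q ∨ ∃ e ∈ Ico a (a + K), e ∈ runEnds M q := by
  by_contra! h
  obtain ⟨h1, h2⟩ := h
  have ha0 : q a ≠ 0 := by
    intro h0
    refine h2 a (by simp; omega) ?_
    simp only [runEnds, mem_filter, mem_range]
    exact ⟨by omega, h0, by simpa [negacyclicDiff, h0] using ha⟩
  refine h1 fun j hj => ?_
  rw [mem_Ico] at hj
  have := forall_ne_zero_of_notMem_runEnds haM ha0
    (fun e h h' => h2 e (mem_Ico.2 ⟨h, h'⟩)) (j - a) (by omega)
  rw [Nat.add_sub_cancel' hj.1] at this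
  simp only [supportBelow, mem_filter, mem_range]
  exact ⟨by omega, this⟩

lemma supportBelow_eq_range_of_runEnds_eq_empty {M : ℕ} {q : ℕ → ℤ} (hE : runEnds M q = ∅)
    (hS : (supportBelow M q).Nonempty) : supportBelow M q = range M := by
  obtain ⟨s, hs⟩ := hS
  simp only [supportBelow, mem_filter, mem_range] at hs
  have hlast : q (M - 1) ≠ 0 := by
    have := forall_ne_zero_of_notMem_runEnds (M := M) (K := M - s) (by omega) hs.2
      (fun e _ _ => by simp [hE]) (M - 1 - s) (by omega)
    rwa [show s + (M - 1 - s) = M - 1 by omega] at this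
  have h0 : q 0 ≠ 0 := by
    intro h0
    have : (0 : ℕ) ∈ runEnds M q :=
      mem_filter.2 ⟨mem_range.2 (by omega), h0, by simpa [negacyclicShift] using hlast⟩
    simp [hE] at this
  refine filter_true_of_mem fun j hj => ?_
  have := forall_ne_zero_of_notMem_runEnds (M := M) (K := M) (by omega) h0
    (fun e _ _ => by simp [hE]) j (by simpa using hj)
  rwa [zero_add] at this

/-- If every window of length `K` starting at a point of the `K`-separated set `A` lies in `S` or
meets `E`, then `#A` is at most the number `a` of full windows plus `#E`, and `K * a ≤ #S`. -/
lemma exists_card_le_add_of_windows {A S E : Finset ℕ} {K : ℕ}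
    (hsep : ∀ a ∈ A, ∀ b ∈ A, a < b → a + K ≤ b)
    (h : ∀ a ∈ A, Ico a (a + K) ⊆ S ∨ ∃ e ∈ Ico a (a + K), e ∈ E) :
    ∃ a : ℕ, #A ≤ a + #E ∧ K * a ≤ #S := by
  classical
  refine ⟨#{a ∈ A | Ico a (a + K) ⊆ S}, ?_, ?_⟩
  · rw [← card_filter_add_card_filter_not (s := A) (fun a => Ico a (a + K) ⊆ S)]
    refine Nat.add_le_add_left ?_ _
    have h' : ∀ a, ∃ e, a ∈ A.filter (fun a => ¬ Ico a (a + K) ⊆ S) →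
        e ∈ Ico a (a + K) ∧ e ∈ E := by
      intro a
      by_cases ha : a ∈ A.filter (fun a => ¬ Ico a (a + K) ⊆ S)
      · obtain ⟨haA, han⟩ := mem_filter.1 ha
        obtain ⟨e, he⟩ := (h a haA).resolve_left han
        exact ⟨e, fun _ => he⟩
      · exact ⟨0, fun h => absurd h ha⟩
    choose f hf using h'
    refine card_le_card_of_injOn f (fun a ha => (hf a ha).2) ?_
    intro a ha b hb hab
    have h1 := mem_Ico.1 (hf a ha).1
    have h2 := mem_Ico.1 (hf b hb).1
    have haA := (mem_filter.1 ha).1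
    have hbA := (mem_filter.1 hb).1
    rcases lt_trichotomy a b with hlt | heq | hgt
    · have := hsep a haA b hbA hlt
      omega
    · exact heq
    · have := hsep b hbA a haA hgt
      omega
  · have hsub : ({a ∈ A | Ico a (a + K) ⊆ S}).biUnion (fun a => Ico a (a + K)) ⊆ S := by
      refine biUnion_subset.2 fun a ha => (mem_filter.1 ha).2
    refine le_trans (le_of_eq ?_) (card_le_card hsub)
    rw [card_biUnion]
    · simp [mul_comm]
    · intro a ha b hb hab
      have haA := (mem_filter.1 ha).1
      have hbA := (mem_filter.1 hb).1
      refine Finset.disjoint_left.2 ?_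
      intro j h1 h2
      simp only [mem_Ico] at h1 h2
      rcases lt_or_gt_of_ne hab with hlt | hgt
      · have := hsep a haA b hbA hlt
        omega
      · have := hsep b hbA a haA hgt
        omega

lemma add_card_le_of_separated {T : Finset ℕ} {M : ℕ}
    (hsep : ∀ a ∈ T, ∀ b ∈ T, a < b → a + #T ≤ b) (hlt : ∀ a ∈ T, 2 * a < M) {a : ℕ}
    (ha : a ∈ T) : a + #T ≤ M := by
  have h2a := hlt a ha
  by_cases hT : 1 < #T
  · obtain ⟨b, hb, hba⟩ := exists_mem_ne hT a
    have h2b := hlt b hb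
    rcases lt_or_gt_of_ne hba with h | h
    · have := hsep b hb a ha h
      omega
    · have := hsep a ha b hb h
      omega
  · omega

lemma two_lt_sum_abs_negacyclicDiff_two {n : ℤ} (hn : 1 < |n|) {q : ℕ → ℤ}
    (h0 : q 0 ≠ 0) (h1 : q 1 ≠ 0) : 2 < ∑ j ∈ range 2, |negacyclicDiff n 2 q j| := by
  simp only [sum_range_succ, sum_range_zero, negacyclicDiff, negacyclicShift]
  simp only [if_true, one_ne_zero, if_false, zero_add, Nat.add_one_sub_one, Nat.sub_self]
  by_contra! hle
  have ha := abs_pos.2 h0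
  have hb := abs_pos.2 h1
  have e1 : |n| * |q 0| ≤ |-q 1 - n * q 0| + |q 1| := by
    rw [← abs_mul]
    have := abs_sub (-q 1 - n * q 0) (-q 1)
    rwa [show -q 1 - n * q 0 - -q 1 = -(n * q 0) by ring, abs_neg, abs_neg] at this
  have e2 : |n| * |q 1| ≤ |q 0 - n * q 1| + |q 0| := by
    rw [← abs_mul]
    have := abs_sub (q 0 - n * q 1) (q 0)
    simpa using this
  have hn2 : |n| = 2 := by nlinarith
  have hq0 : |q 0| = 1 := by nlinarith
  have hq1 : |q 1| = 1 := by nlinarith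
  rcases (abs_eq (by norm_num)).1 hn2 with h | h <;>
  rcases (abs_eq (by norm_num)).1 hq0 with h' | h' <;>
  rcases (abs_eq (by norm_num)).1 hq1 with h'' | h'' <;>
  norm_num [h, h', h''] at hle

/-- The configuration with exponents `a`, `a + 2` and a carry run of length two is too costly. -/
lemma four_lt_abs_add_abs_add_abs {n u v : ℤ} (hn : 1 < |n|) (h1 : 1 ≤ -(n * u))
    (h2 : 1 ≤ v) : 4 < |-(n * u)| + |u - n * v| + |v| := by
  by_contra! hle
  have hu : u ≠ 0 := by rintro rfl; simp at h1
  have hu' := abs_pos.2 hu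
  have e : |-(n * u)| = |n| * |u| := by rw [abs_neg, abs_mul]
  have e' : |n| * |v| ≤ |u - n * v| + |u| := by
    rw [← abs_mul]
    simpa using abs_sub (u - n * v) u
  have hv : |v| = v := abs_of_pos (by omega)
  rw [e, hv] at hle
  rw [hv] at e'
  have hnu : 2 ≤ |n| * |u| := by nlinarith
  have := abs_nonneg (u - n * v)
  have hn2 : |n| = 2 := by nlinarith
  rw [hn2] at hle e'
  have hu1 : |u| = 1 := by omega
  have hv1 : v = 1 := by omega
  subst hv1
  rcases (abs_eq (by norm_num)).1 hn2 with h | h <;>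
  rcases (abs_eq (by norm_num)).1 hu1 with h' | h' <;>
  simp [h, h'] at hle h1

lemma sum_three_le_sum_range {f : ℕ → ℤ} (hf : ∀ j, 0 ≤ f j) {a M : ℕ} (h : a + 2 < M) :
    f a + f (a + 1) + f (a + 2) ≤ ∑ j ∈ range M, f j := by
  have hsub : ({a, a + 1, a + 2} : Finset ℕ) ⊆ range M := by
    intro j hj
    simp only [mem_insert, mem_singleton] at hj
    rw [mem_range]
    omega
  refine le_trans (le_of_eq ?_) (sum_le_sum_of_subset_of_nonneg hsub fun j _ _ => hf j)
  rw [sum_insert (by simp), sum_insert (by simp), sum_singleton]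
  ring

theorem supportBelow_eq_empty_of_sum_abs_le {n : ℤ} (hn : 1 < |n|) {M : ℕ} (hM : Even M)
    {T : Finset ℕ} (hT : T.Nonempty) (hsep : ∀ a ∈ T, ∀ b ∈ T, a < b → a + #T ≤ b)
    (hlt : ∀ a ∈ T, 2 * a < M) {q : ℕ → ℤ}
    (hle : ∑ j ∈ range M, |negacyclicDiff n M q j| ≤ 2 * #{a ∈ T | 1 ≤ negacyclicDiff n M q a}) :
    supportBelow M q = ∅ := by
  by_contra hne
  have hS := nonempty_iff_ne_empty.2 hne
  have hSpos := card_pos.2 hS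
  set A := {a ∈ T | 1 ≤ negacyclicDiff n M q a} with hA
  have hAT : A ⊆ T := filter_subset _ _
  have hAcard := card_le_card hAT
  have hK : 1 ≤ #T := card_pos.2 hT
  have hw := card_support_add_two_mul_card_runEnds_le hn M q
  have hw' : #(supportBelow M q) + 2 * #(runEnds M q) ≤ 2 * #A := by
    have := hw.trans hle
    exact_mod_cast this
  have hwin : ∀ a ∈ A, Ico a (a + #T) ⊆ supportBelow M q ∨
      ∃ e ∈ Ico a (a + #T), e ∈ runEnds M q := by
    intro a ha
    refine window_full_or_meets_runEnds hK (add_card_le_of_separated hsep hlt (hAT ha)) (n := n) ?_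
    have := (mem_filter.1 ha).2
    omega
  obtain ⟨c, hc, hc'⟩ := exists_card_le_add_of_windows
    (fun a ha b hb => hsep a (hAT ha) b (hAT hb)) hwin
  have hfull : runEnds M q = ∅ → supportBelow M q = range M := fun h =>
    supportBelow_eq_range_of_runEnds_eq_empty h hS
  have hEpos : runEnds M q ≠ ∅ → 0 < #(runEnds M q) := fun h =>
    card_pos.2 (nonempty_iff_ne_empty.2 h)
  obtain ⟨t, ht⟩ := hT
  have htM := hlt t ht
  rcases lt_or_ge #T 3 with hT3 | hT3
  · by_cases hE : runEnds M q = ∅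
    · have hSr := hfull hE
      rw [hSr, card_range] at hw'
      have hT1 : #T = 1 := by
        by_contra hT1
        obtain ⟨b, hb, hbt⟩ := exists_mem_ne (s := T) (by omega) t
        have := hlt b hb
        have := hsep b hb t ht
        have := hsep t ht b hb
        obtain ⟨k, rfl⟩ := hM
        omega
      have hM2 : M = 2 := by
        obtain ⟨k, rfl⟩ := hM
        omega
      subst hM2
      have hq : ∀ j < 2, q j ≠ 0 := fun j hj => by
        have : j ∈ supportBelow 2 q := by rw [hSr]; simpa using hj
        exact (mem_filter.1 this).2
      have := two_lt_sum_abs_negacyclicDiff_two hn (hq 0 (by norm_num)) (hq 1 (by norm_num))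
      have h2 : (#A : ℤ) ≤ 1 := by exact_mod_cast hAcard.trans hT1.le
      omega
    · have := hEpos hE
      have hT2 : #T = 2 := by omega
      have hA2 : #A = 2 := by omega
      rw [hT2] at hc' hwin
      have hS2 : #(supportBelow M q) = 2 := by omega
      have hE1 : #(runEnds M q) = 1 := by omega
      -- Otherwise two disjoint windows would both contain the only run end.
      obtain ⟨a, ha, hfa⟩ : ∃ a ∈ A, Ico a (a + 2) ⊆ supportBelow M q := by
        by_contra! hnone
        obtain ⟨d, hd, hd'⟩ := exists_card_le_add_of_windows (S := ∅)
          (fun a ha b hb h => by simpa [hT2] using hsep a (hAT ha) b (hAT hb) h)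
          (fun a ha => Or.inr ((hwin a ha).resolve_left (hnone a ha)))
        simp at hd'
        omega
      have hSeq : Ico a (a + 2) = supportBelow M q :=
        eq_of_subset_of_card_le hfa (by simp [hS2])
      have hmem : ∀ j < M, q j ≠ 0 ↔ (a ≤ j ∧ j < a + 2) := by
        intro j hj
        have : j ∈ supportBelow M q ↔ j ∈ Ico a (a + 2) := by rw [hSeq]
        simpa [supportBelow, hj] using this
      obtain ⟨b, hb, hba⟩ := exists_mem_ne (s := A) (by omega) a
      have hda := (mem_filter.1 ha).2
      have hdb := (mem_filter.1 hb).2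
      have haM := hlt a (hAT ha)
      have hbM := hlt b (hAT hb)
      have hs1 := hsep a (hAT ha) b (hAT hb)
      have hs2 := hsep b (hAT hb) a (hAT ha)
      have hqb : q b = 0 := by
        by_contra h
        have := (hmem b (by omega)).1 h
        omega
      have hshift : negacyclicShift M q b ≠ 0 := by
        intro h
        simp [negacyclicDiff, hqb, h] at hdb
      have hbeq : b = a + 2 := by
        unfold negacyclicShift at hshift
        split_ifs at hshift with h0
        · have := (hmem (M - 1) (by omega)).1 (by simpa using hshift)
          omega
        · have := (hmem (b - 1) (by omega)).1 hshift
          omega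
      subst hbeq
      have hqprev : negacyclicShift M q a = 0 := by
        by_contra h
        unfold negacyclicShift at h
        split_ifs at h with h0
        · have := (hmem (M - 1) (by omega)).1 (by simpa using h)
          omega
        · have := (hmem (a - 1) (by omega)).1 h
          omega
      have e0 : negacyclicDiff n M q a = -(n * q a) := by simp [negacyclicDiff, hqprev]
      have e1 : negacyclicDiff n M q (a + 1) = q a - n * q (a + 1) := by
        simp [negacyclicDiff, negacyclicShift]
      have e2 : negacyclicDiff n M q (a + 2) = q (a + 1) := by
        simp [negacyclicDiff, negacyclicShift, hqb]
      have h3 := sum_three_le_sum_range (f := fun j => |negacyclicDiff n M q j|)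
        (fun j => abs_nonneg _) (a := a) (M := M) (by omega)
      simp only [e0, e1, e2] at h3 hda hdb
      have := four_lt_abs_add_abs_add_abs hn hda hdb
      rw [hA2] at hle
      push_cast at hle
      omega
  · have : 3 * c ≤ #T * c := Nat.mul_le_mul_right _ hT3
    omega

open Polynomial in
/-- A polynomial of degree less than `M` whose value at `n` is `X * (n ^ M + 1)` is, modulo
`t ^ M + 1`, a multiple of `t - n`. -/
lemma exists_coeff_eq_negacyclicDiff {P : ℤ[X]} {n c : ℤ} {M : ℕ} (hM : 0 < M)
    (hdeg : P.natDegree < M) (hP : c * (n ^ M + 1) = P.eval n) :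
    ∃ q : ℕ → ℤ, (∀ j < M, P.coeff j = negacyclicDiff n M q j) ∧ q (M - 1) = -c := by
  obtain ⟨Q, hQ⟩ : (X - C n) ∣ P - C c * (X ^ M + 1) := by
    rw [dvd_iff_isRoot]
    simp [← hP]
  rw [mul_comm (Polynomial.X - C n)] at hQ
  obtain ⟨m, rfl⟩ : ∃ m, M = m + 1 := ⟨M - 1, by omega⟩
  have hcoeff : ∀ j, P.coeff j - c * ((if j = m + 1 then 1 else 0) + if j = 0 then 1 else 0) =
      (Q * (X - C n)).coeff j := by
    intro j
    rw [← hQ]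
    simp [coeff_X_pow, coeff_one]
  have hQdeg : Q.coeff (m + 1) = 0 := by
    by_cases hQ0 : Q = 0
    · simp [hQ0]
    · refine coeff_eq_zero_of_natDegree_lt ?_
      have h1 : (Q * (X - C n)).natDegree = Q.natDegree + 1 := by
        rw [natDegree_mul hQ0 (X_sub_C_ne_zero n), natDegree_X_sub_C]
      have h2 : (P - C c * (X ^ (m + 1) + 1)).natDegree ≤ m + 1 := by
        compute_degree!
        omega
      rw [hQ, h1] at h2
      omega
  have hlast : Q.coeff m = -c := by
    have := hcoeff (m + 1)
    rw [coeff_mul_X_sub_C, hQdeg, coeff_eq_zero_of_natDegree_lt hdeg] at this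
    simpa using this.symm
  refine ⟨Q.coeff, fun j hj => ?_, hlast⟩
  have := hcoeff j
  cases j with
  | zero =>
    simp [mul_sub, mul_coeff_zero] at this
    simp [negacyclicDiff, negacyclicShift, hlast]
    linarith
  | succ j =>
    rw [coeff_mul_X_sub_C, if_neg (by omega), if_neg (by omega)] at this
    simp [negacyclicDiff, negacyclicShift]
    linarith

/-- Uniqueness of signed power representations modulo `n^M + 1`: under the
gap hypotheses on `p₁ < ⋯ < p_K < M/2`, any solution of
`X(n^M + 1) = (n^{p₁} + ⋯ + n^{p_K}) - Σᵢ εᵢ n^{xᵢ}` with `0 ≤ xᵢ < M` and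
`εᵢ = ±1` satisfies `X = 0`, all `εᵢ = 1`, `l = K`, and
`{x₁,…,x_l} = {p₁,…,p_K}` as multisets. -/
theorem stmt_13 (n : ℤ) (hn : 1 < |n|) (K M l : ℕ) (hK : 1 ≤ K) (hM : Even M)
    (p : Fin K → ℕ) (hmono : StrictMono p) (hlt : ∀ i, 2 * p i < M)
    (hgap : ∀ i : Fin K, ∀ h : i.val + 1 < K, p i + K ≤ p ⟨i.val + 1, h⟩)
    (hl : l ≤ K) (X : ℤ) (x : Fin l → ℕ) (hx : ∀ i, x i < M)
    (ε : Fin l → ℤ) (hε : ∀ i, ε i = 1 ∨ ε i = -1)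
    (heq : X * (n ^ M + 1) =
      (∑ i, n ^ (p i)) - ∑ i, ε i * n ^ (x i)) :
    X = 0 ∧ (∀ i, ε i = 1) ∧ l = K ∧
      Finset.univ.val.map x = Finset.univ.val.map p := by
  have hMpos : 0 < M := by have := hlt ⟨0, hK⟩; omega
  set T : Finset ℕ := univ.image p with hTdef
  have hTcard : #T = K := by
    rw [hTdef, card_image_of_injective _ hmono.injective, card_univ, Fintype.card_fin]
  have hsep : ∀ a ∈ T, ∀ b ∈ T, a < b → a + #T ≤ b := by
    intro a ha b hb hab
    obtain ⟨i, -, rfl⟩ := mem_image.1 ha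
    obtain ⟨j, -, rfl⟩ := mem_image.1 hb
    have hij : i < j := hmono.lt_iff_lt.1 hab
    have hi : i.val + 1 < K := by omega
    rw [hTcard]
    exact (hgap i hi).trans (hmono.monotone (show (⟨i.val + 1, hi⟩ : Fin K) ≤ j from hij))
  have hTlt : ∀ a ∈ T, 2 * a < M := by
    intro a ha
    obtain ⟨i, -, rfl⟩ := mem_image.1 ha
    exact hlt i
  set F : Polynomial ℤ := ∑ i, Polynomial.X ^ (p i) with hF
  set G : Polynomial ℤ := ∑ i, Polynomial.C (ε i) * Polynomial.X ^ (x i) with hG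
  have hFc : ∀ j, F.coeff j = if j ∈ T then 1 else 0 := by
    intro j
    rw [hF, Polynomial.finsetSum_coeff]
    simp only [Polynomial.coeff_X_pow]
    split_ifs with hj
    · obtain ⟨i, -, rfl⟩ := mem_image.1 hj
      simp [hmono.injective.eq_iff]
    · refine sum_eq_zero fun i _ => if_neg ?_
      rintro rfl
      exact hj (mem_image_of_mem p (mem_univ i))
  have hGc : ∀ j, G.coeff j = ∑ i, ε i * if j = x i then 1 else 0 := by
    intro j
    simp [hG, Polynomial.coeff_X_pow]
  have hdeg : (F - G).natDegree < M := by
    rw [Nat.lt_iff_le_pred hMpos, Polynomial.natDegree_le_iff_coeff_eq_zero]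
    intro j hj
    rw [Polynomial.coeff_sub, hFc, hGc, if_neg, sum_eq_zero, sub_zero]
    · intro i _
      have := hx i
      rw [if_neg (by omega), mul_zero]
    · intro h
      have := hTlt j h
      omega
  obtain ⟨q, hq, hqX⟩ := exists_coeff_eq_negacyclicDiff (n := n) (c := X) hMpos hdeg
    (by simp [heq, hF, hG, Polynomial.eval_finsetSum])
  have hGsum : ∑ j ∈ range M, |G.coeff j| ≤ K := by
    calc ∑ j ∈ range M, |G.coeff j|
        ≤ ∑ j ∈ range M, ∑ i, (if j = x i then (1 : ℤ) else 0) := by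
          refine sum_le_sum fun j _ => ?_
          rw [hGc]
          refine (abs_sum_le_sum_abs _ _).trans (sum_le_sum fun i _ => ?_)
          rcases hε i with h | h <;> split_ifs <;> simp [h]
      _ = l := by
          rw [sum_comm]
          simp [hx]
      _ ≤ K := by exact_mod_cast hl
  have hTsub : T ⊆ range M := fun a ha => by
    have := hTlt a ha
    rw [mem_range]
    omega
  have hle : ∑ j ∈ range M, |negacyclicDiff n M q j| ≤
      2 * #{a ∈ T | 1 ≤ negacyclicDiff n M q a} := by
    have hpt : ∀ j ∈ range M, |negacyclicDiff n M q j| + (if j ∈ T then 1 else 0) ≤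
        |G.coeff j| + 2 * (if j ∈ T then (if 1 ≤ negacyclicDiff n M q j then 1 else 0) else 0) := by
      intro j hj
      rw [← hq j (mem_range.1 hj), Polynomial.coeff_sub, hFc]
      split_ifs <;> grind
    have := sum_le_sum hpt
    rw [sum_add_distrib, sum_add_distrib, ← mul_sum, sum_ite_mem, sum_ite_mem,
      inter_eq_right.2 hTsub] at this
    simp only [sum_const, hTcard, sum_boole] at this
    simp at this
    linarith
  have hS := supportBelow_eq_empty_of_sum_abs_le hn hM
    (card_pos.1 (by omega)) hsep hTlt hle
  have hq0 : ∀ j < M, q j = 0 := by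
    intro j hj
    by_contra h
    have : j ∈ supportBelow M q := mem_filter.2 ⟨mem_range.2 hj, h⟩
    simp [hS] at this
  have hFG : F = G := by
    rw [← sub_eq_zero]
    ext j
    rcases lt_or_ge j M with hj | hj
    · rw [hq j hj, negacyclicDiff, negacyclicShift, hq0 j hj]
      split_ifs
      · simp [hq0 (M - 1) (by omega)]
      · simp [hq0 (j - 1) (by omega)]
    · simpa using Polynomial.coeff_eq_zero_of_natDegree_lt (hdeg.trans_le hj)
  have hsumε : (K : ℤ) = ∑ i, ε i := by
    have := congrArg (Polynomial.eval 1) hFG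
    simpa [hF, hG, Polynomial.eval_finsetSum] using this
  have hε1 : ∀ i ∈ univ, ε i ≤ 1 := fun i _ => by rcases hε i with h | h <;> simp [h]
  have hsuml : ∑ i, ε i ≤ l := (sum_le_sum hε1).trans (by simp)
  have hlK : l = K := by omega
  have hall : ∀ i, ε i = 1 := by
    have := (sum_eq_sum_iff_of_le hε1).1 (by simp [← hsumε, hlK])
    exact fun i => this i (mem_univ i)
  refine ⟨by have := hq0 (M - 1) (by omega); omega, hall, hlK, ?_⟩
  ext j
  have hj := congrArg (fun P => Polynomial.coeff P j) hFG
  simp only [hF, hG, Polynomial.finsetSum_coeff, hall, map_one, one_mul,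
    Polynomial.coeff_X_pow, sum_boole] at hj
  simp only [Multiset.count_map]
  exact_mod_cast hj.symm
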